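/- The class of languages recognized by high-level TOPL automata is closed under Kleene star: for any hl-TOPL automaton A over an alphabet Σ = V^n, there exists a hl-TOPL automaton B over Σ with L(B) = L(A)*, the set of all finite concatenations (including the empty word) of words from L(A). -/

import Mathlib

namespace Topl

/-- Guards over `m` registers and letters that are `n`-tuples. -/
inductive Guard (m n : ℕ) : Type
  | eq : Fin m → Fin n → Guard m n
  | neq : Fin m → Fin n → Guard m n
  | tt : Guard m n
  | and : Guard m n → Guard m n → Guard m n
  deriving DecidableEq

/-- Actions over `m` registers and letters that are `n`-tuples. -/
inductive Action (m n : ℕ) : Type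
  | nop : Action m n
  | set : Fin m → Fin n → Action m n
  | seq : Action m n → Action m n → Action m n
  deriving DecidableEq

/-- Satisfaction of a guard by a store `s` and a letter `ℓ`. -/
def Guard.Sat {V : Type} {m n : ℕ} (s : Fin m → V) (ℓ : Fin n → V) : Guard m n → Prop
  | .eq i j => s i = ℓ j
  | .neq i j => s i ≠ ℓ j
  | .tt => True
  | .and g₁ g₂ => Guard.Sat s ℓ g₁ ∧ Guard.Sat s ℓ g₂

/-- The store transformation of an action on input letter `ℓ`:
`nop(ℓ)(s) = s`, `(set i := j)(ℓ)(s) = s[i ↦ ℓ(j)]`, `(a₁;a₂)(ℓ) = a₁(ℓ) ∘ a₂(ℓ)`. -/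
def Action.run {V : Type} {m n : ℕ} (ℓ : Fin n → V) : Action m n → (Fin m → V) → (Fin m → V)
  | .nop, s => s
  | .set i j, s => Function.update s i (ℓ j)
  | .seq a₁ a₂, s => Action.run ℓ a₁ (Action.run ℓ a₂ s)

/-- A TOPL automaton with `m` registers over `n`-tuples, whose set of states is `Fin k`. -/
structure TOPL (V : Type) (m n k : ℕ) where
  q₀ : Fin k
  s₀ : Fin m → V
  δ : Finset (Fin k × (Guard m n × Action m n) × Fin k)
  F : Finset (Fin k)

namespace TOPL

variable {V : Type} {m n k : ℕ}

/-- One edge of the configuration graph, labelled by a letter. -/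
def Step (A : TOPL V m n k) (x₁ : Fin k × (Fin m → V)) (ℓ : Fin n → V)
    (x₂ : Fin k × (Fin m → V)) : Prop :=
  ∃ g a, (x₁.1, (g, a), x₂.1) ∈ A.δ ∧ Guard.Sat x₁.2 ℓ g ∧ Action.run ℓ a x₁.2 = x₂.2

/-- Walks in the configuration graph, labelled by words. -/
inductive Reach (A : TOPL V m n k) :
    Fin k × (Fin m → V) → List (Fin n → V) → Fin k × (Fin m → V) → Prop
  | nil (x) : Reach A x [] x
  | cons {x₁ x₂ x₃ ℓ w} : A.Step x₁ ℓ x₂ → Reach A x₂ w x₃ → Reach A x₁ (ℓ :: w) x₃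

/-- The language of a TOPL automaton: words labelling walks from the initial
configuration to a configuration whose state is final. -/
def Lang (A : TOPL V m n k) : Set (List (Fin n → V)) :=
  { w | ∃ x, A.Reach (A.q₀, A.s₀) w x ∧ x.1 ∈ A.F }

end TOPL

/-- A high-level TOPL automaton: transitions are labelled by finite sequences of
guard–action pairs. -/
structure HlTOPL (V : Type) (m n k : ℕ) where
  q₀ : Fin k
  s₀ : Fin m → V
  δ : Finset (Fin k × List (Guard m n × Action m n) × Fin k)
  F : Finset (Fin k)

namespace HlTOPL

variable {V : Type} {m n k : ℕ}

/-- `SeqAccept s gas w s'` holds when the TOPL automaton `T(s; gas)` accepts the word `w`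
ending with store `s'`. -/
inductive SeqAccept {V : Type} {m n : ℕ} :
    (Fin m → V) → List (Guard m n × Action m n) → List (Fin n → V) → (Fin m → V) → Prop
  | nil (s) : SeqAccept s [] [] s
  | cons {s s' g a gas ℓ w} : Guard.Sat s ℓ g → SeqAccept (Action.run ℓ a s) gas w s' →
      SeqAccept s ((g, a) :: gas) (ℓ :: w) s'

/-- A standard transition starts from the hl-configuration `(x, v)`. -/
def StdFrom (A : HlTOPL V m n k) (x : Fin k × (Fin m → V)) (v : List (Fin n → V)) : Prop :=
  ∃ q₂ s₂ gas u u', v = u ++ u' ∧ (x.1, gas, q₂) ∈ A.δ ∧ SeqAccept x.2 gas u s₂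

/-- One edge of the hl-configuration graph: a standard transition or a skip transition. -/
inductive HlStep (A : HlTOPL V m n k) :
    (Fin k × (Fin m → V)) × List (Fin n → V) → List (Fin n → V) →
    (Fin k × (Fin m → V)) × List (Fin n → V) → Prop
  | std {q₁ s₁ q₂ s₂ gas w w'} : (q₁, gas, q₂) ∈ A.δ → SeqAccept s₁ gas w s₂ →
      HlStep A ((q₁, s₁), w ++ w') w ((q₂, s₂), w')
  | skip {q s ℓ w} : ¬ A.StdFrom (q, s) (ℓ :: w) → HlStep A ((q, s), ℓ :: w) [ℓ] ((q, s), w)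

/-- Paths in the hl-configuration graph, labelled by the concatenation of the step labels. -/
inductive Path (A : HlTOPL V m n k) :
    (Fin k × (Fin m → V)) × List (Fin n → V) → List (Fin n → V) →
    (Fin k × (Fin m → V)) × List (Fin n → V) → Prop
  | nil (y) : Path A y [] y
  | cons {y₁ y₂ y₃ u w} : A.HlStep y₁ u y₂ → Path A y₂ w y₃ → Path A y₁ (u ++ w) y₃

/-- The language of a high-level TOPL automaton: words labelling paths from an initial
hl-configuration to a final one. -/
def Lang (A : HlTOPL V m n k) : Set (List (Fin n → V)) :=
  { w | ∃ (w₀ : List (Fin n → V)) (q : Fin k) (s : Fin m → V),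
      A.Path ((A.q₀, A.s₀), w₀) w ((q, s), ([] : List (Fin n → V))) ∧ q ∈ A.F }

end HlTOPL

/-- The Kleene star of a language of words: all finite concatenations
(including the empty word) of words from `L`. -/
def kstar {α : Type} (L : Set (List α)) : Set (List α) :=
  { w | ∃ ws : List (List α), (∀ u ∈ ws, u ∈ L) ∧ w = ws.flatten }

/-! ### Symbolic evaluation of guards and actions -/

section Symbolic

variable {V : Type} {m n : ℕ}

/-- Evaluation of a guard from the equality pattern between registers and letter components. -/
def Guard.Holds (E : Fin m → Fin n → Prop) : Guard m n → Prop
  | .eq i j => E i j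
  | .neq i j => ¬ E i j
  | .tt => True
  | .and g₁ g₂ => g₁.Holds E ∧ g₂.Holds E

theorem Guard.holds_iff_sat (s : Fin m → V) (ℓ : Fin n → V) (g : Guard m n) :
    g.Holds (fun i j => s i = ℓ j) ↔ Guard.Sat s ℓ g := by
  induction g with
  | eq i j => rfl
  | neq i j => rfl
  | tt => rfl
  | and g₁ g₂ h₁ h₂ => exact and_congr h₁ h₂

/-- The origin (old register or letter component) of each register's value after an action. -/
def Action.src : Action m n → Fin m → Fin m ⊕ Fin n
  | .nop, r => .inl r
  | .set i j, r => if r = i then .inr j else .inl r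
  | .seq a₁ a₂, r => Sum.elim a₂.src .inr (a₁.src r)

theorem Action.run_apply (ℓ : Fin n → V) (a : Action m n) (s : Fin m → V) (r : Fin m) :
    a.run ℓ s r = Sum.elim s ℓ (a.src r) := by
  induction a generalizing s r with
  | nop => rfl
  | set i j => by_cases h : r = i <;> simp [Action.run, Action.src, h]
  | seq a₁ a₂ h₁ h₂ =>
    rw [Action.run, h₁, Action.src]
    cases a₁.src r with
    | inl i => exact h₂ s i
    | inr j => rfl

/-- A guard which holds exactly when the equality pattern is `E`. -/
noncomputable def Guard.ofPattern (E : Fin m → Fin n → Prop) : Guard m n :=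
  open Classical in
  ((List.finRange m).product (List.finRange n)).foldr
    (fun p g => .and (if E p.1 p.2 then .eq p.1 p.2 else .neq p.1 p.2) g) .tt

theorem Guard.sat_ofPattern (E : Fin m → Fin n → Prop) (s : Fin m → V) (ℓ : Fin n → V) :
    Guard.Sat s ℓ (Guard.ofPattern E) ↔ (fun i j => s i = ℓ j) = E := by
  classical
  have key : ∀ L : List (Fin m × Fin n), Guard.Sat s ℓ (L.foldr
      (fun p g => .and (if E p.1 p.2 then .eq p.1 p.2 else .neq p.1 p.2) g) .tt) ↔
      ∀ p ∈ L, (s p.1 = ℓ p.2 ↔ E p.1 p.2) := by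
    intro L
    induction L with
    | nil => simp [Guard.Sat]
    | cons p L ih =>
      rw [List.foldr_cons, Guard.Sat, ih, List.forall_mem_cons]
      by_cases h : E p.1 p.2 <;> simp [h, Guard.Sat]
  rw [Guard.ofPattern, key]
  constructor
  · intro h
    funext i j
    exact propext (h (i, j) (List.mem_product.2 ⟨List.mem_finRange i, List.mem_finRange j⟩))
  · rintro rfl p -
    rfl

/-- The action writing each letter component `j` to the register `e j`. -/
def Action.write (e : Fin n → Fin m) : Action m n :=
  (List.finRange n).foldr (fun j a => .seq (.set (e j) j) a) .nop

theorem Action.run_write_of_notMem (e : Fin n → Fin m) (ℓ : Fin n → V) (s : Fin m → V)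
    {r : Fin m} (hr : ∀ j, e j ≠ r) : (Action.write e).run ℓ s r = s r := by
  unfold Action.write
  induction List.finRange n with
  | nil => rfl
  | cons j L ih => simpa [Action.run, Function.update_of_ne (hr j).symm] using ih

theorem Action.run_write_apply {e : Fin n → Fin m} (he : e.Injective) (ℓ : Fin n → V)
    (s : Fin m → V) (j : Fin n) : (Action.write e).run ℓ s (e j) = ℓ j := by
  have key : ∀ L : List (Fin n), j ∈ L →
      Action.run ℓ (L.foldr (fun j a => .seq (.set (e j) j) a) .nop) s (e j) = ℓ j := by
    intro L
    induction L with
    | nil => simp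
    | cons i L ih =>
      intro hj
      by_cases h : j = i
      · simp [Action.run, h]
      · have hj' : j ∈ L := by simpa [h] using hj
        simpa [Action.run, Function.update_of_ne (he.ne h)] using ih hj'
  exact key _ (List.mem_finRange j)

end Symbolic

/-! ### Register automata with silent moves and register copying -/

/-- A register automaton without skip transitions, in which each move may also permute and
duplicate the contents of the registers. -/
structure CopyAutomaton (V : Type) (n : ℕ) (C R : Type) where
  start : C
  store : R → V
  final : Set C
  eps : C → C → (R → R) → Prop
  tr : C → (R → Fin n → Prop) → C → (R → R ⊕ Fin n) → Prop

namespace CopyAutomaton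

variable {V : Type} {n p k : ℕ} {C R : Type}

/-- Runs of a copy automaton, labelled by words. -/
inductive Run (M : CopyAutomaton V n C R) :
    C → (R → V) → List (Fin n → V) → C → (R → V) → Prop
  | nil (c ρ) : Run M c ρ [] c ρ
  | eps {c ρ w c' c'' ρ'' h} : M.eps c c' h → Run M c' (ρ ∘ h) w c'' ρ'' →
      Run M c ρ w c'' ρ''
  | letter {c ρ ℓ w c' c'' ρ'' h} : M.tr c (fun r j => ρ r = ℓ j) c' h →
      Run M c' (fun r => Sum.elim ρ ℓ (h r)) w c'' ρ'' → Run M c ρ (ℓ :: w) c'' ρ''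

theorem Run.trans {M : CopyAutomaton V n C R} {c c' c'' : C} {ρ ρ' ρ'' : R → V}
    {u w : List (Fin n → V)} (h₁ : M.Run c ρ u c' ρ') (h₂ : M.Run c' ρ' w c'' ρ'') :
    M.Run c ρ (u ++ w) c'' ρ'' := by
  induction h₁ with
  | nil => exact h₂
  | eps he _ ih => exact .eps he (ih h₂)
  | letter ht _ ih => exact .letter ht (ih h₂)

/-- The language of a copy automaton. -/
def Lang (M : CopyAutomaton V n C R) : Set (List (Fin n → V)) :=
  { w | ∃ c ρ, M.Run M.start M.store w c ρ ∧ c ∈ M.final }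

/-- Labels of the compiled automaton: silent moves, escapes to the sink, and letter moves given
by an equality pattern and the registers to be written. -/
abbrev Label (n p : ℕ) : Type := Option (Option ((Fin p → Fin n → Prop) × (Fin n → Fin p)))

/-- The sequence of guard–action pairs of a label. -/
noncomputable def Label.word : Label n p → List (Guard p n × Action p n)
  | none => []
  | some none => [(.tt, .nop)]
  | some (some (E, e)) => [(.ofPattern E, .write e)]

/-- Edges of the compiled automaton. A state is the sink `none`, or a control state with a map
sending each register of `M` to the physical register which holds its value. -/
inductive Edge (M : CopyAutomaton V n C R) (p : ℕ) :
    Option (C × (R → Fin p)) → Label n p → Option (C × (R → Fin p)) → Prop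
  | eps {c c' h f} : M.eps c c' h → Edge M p (some (c, f)) none (some (c', f ∘ h))
  | letter {c c' h f E e} : e.Injective → (∀ j r, e j ≠ f r) →
      M.tr c (fun r j => E (f r) j) c' h →
      Edge M p (some (c, f)) (some (some (E, e))) (some (c', fun r => Sum.elim f e (h r)))
  | sink (c f) : Edge M p (some (c, f)) (some none) none

/-- The hl-TOPL automaton simulating a copy automaton. -/
noncomputable def compile [Finite C] [Finite R] (M : CopyAutomaton V n C R)
    (e : Option (C × (R → Fin p)) ≃ Fin k) (f₀ : R → Fin p) (s₀ : Fin p → V) :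
    HlTOPL V p n k where
  q₀ := e (some (M.start, f₀))
  s₀ := s₀
  δ := (Set.toFinite { t : Option (C × (R → Fin p)) × Label n p × Option (C × (R → Fin p)) |
    M.Edge p t.1 t.2.1 t.2.2 }).toFinset.image fun t => (e t.1, t.2.1.word, e t.2.2)
  F := (Set.toFinite { q | ∃ c ∈ M.final, ∃ f, q = e (some (c, f)) }).toFinset

theorem elim_write {f : R → Fin p} {d : Fin n → Fin p} (hd : d.Injective)
    (hf : ∀ j r, d j ≠ f r) (h : R → R ⊕ Fin n) (s : Fin p → V) (ℓ : Fin n → V) :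
    (Action.write d).run ℓ s ∘ (fun r => Sum.elim f d (h r)) =
      fun r => Sum.elim (s ∘ f) ℓ (h r) := by
  funext r
  simp only [Function.comp_apply]
  cases h r with
  | inl i => exact Action.run_write_of_notMem d ℓ s fun j => hf j i
  | inr j => exact Action.run_write_apply hd ℓ s j

theorem exists_fresh [Fintype R] (hp : Fintype.card R + n ≤ p) (f : R → Fin p) :
    ∃ d : Fin n → Fin p, d.Injective ∧ ∀ j r, d j ≠ f r := by
  classical
  have hcard : Fintype.card (Fin n) ≤ Fintype.card ↥((Finset.univ.image f)ᶜ) := by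
    have h := Finset.card_image_le (s := Finset.univ) (f := f)
    rw [Finset.card_univ] at h
    rw [Fintype.card_coe, Finset.card_compl, Fintype.card_fin, Fintype.card_fin]
    omega
  obtain ⟨d⟩ := Function.Embedding.nonempty_of_card_le hcard
  refine ⟨fun j => d j, fun i j h => d.injective (Subtype.ext h), fun j r h => ?_⟩
  have := (d j).2
  rw [show (d j : Fin p) = f r from h] at this
  simp at this

section Compile

variable [Finite C] [Finite R] {M : CopyAutomaton V n C R}
  {e : Option (C × (R → Fin p)) ≃ Fin k} {f₀ : R → Fin p} {s₀ : Fin p → V}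

theorem mem_compile_δ {x : Option (C × (R → Fin p))} {gas : List (Guard p n × Action p n)}
    {q : Fin k} : (e x, gas, q) ∈ (M.compile e f₀ s₀).δ ↔
      ∃ b y, M.Edge p x b y ∧ gas = b.word ∧ q = e y := by
  simp only [compile, Finset.mem_image, Set.Finite.mem_toFinset, Set.mem_ofPred_eq, Prod.exists,
    Prod.mk.injEq, EmbeddingLike.apply_eq_iff_eq]
  constructor
  · rintro ⟨x', b, y, hE, rfl, rfl, rfl⟩
    exact ⟨b, y, hE, rfl, rfl⟩
  · rintro ⟨b, y, hE, rfl, rfl⟩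
    exact ⟨x, b, y, hE, rfl, rfl, rfl⟩

theorem mem_compile_F {x : Option (C × (R → Fin p))} :
    e x ∈ (M.compile e f₀ s₀).F ↔ ∃ c ∈ M.final, ∃ f, x = some (c, f) := by
  simp [compile]

theorem stdFrom_compile (c : C) (f : R → Fin p) (s : Fin p → V) (ℓ : Fin n → V)
    (w : List (Fin n → V)) : (M.compile e f₀ s₀).StdFrom (e (some (c, f)), s) (ℓ :: w) :=
  ⟨e none, s, [(.tt, .nop)], [ℓ], w, rfl,
    mem_compile_δ.2 ⟨_, _, .sink c f, rfl, rfl⟩, .cons trivial (.nil _)⟩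

theorem path_compile_none {y₁ y₂ : (Fin k × (Fin p → V)) × List (Fin n → V)}
    {w : List (Fin n → V)} (h : (M.compile e f₀ s₀).Path y₁ w y₂) (h₁ : y₁.1.1 = e none) :
    y₂.1.1 = e none := by
  induction h with
  | nil => exact h₁
  | cons hs _ ih =>
    apply ih
    cases hs with
    | std hδ _ =>
      obtain rfl : _ = e none := h₁
      obtain ⟨b, y, hE, -⟩ := mem_compile_δ.1 hδ
      cases hE
    | skip _ => exact h₁

theorem run_of_path_compile {y₁ y₂ : (Fin k × (Fin p → V)) × List (Fin n → V)}
    {w : List (Fin n → V)} (h : (M.compile e f₀ s₀).Path y₁ w y₂)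
    (h₂ : y₂.1.1 ∈ (M.compile e f₀ s₀).F) (c : C) (f : R → Fin p)
    (h₁ : y₁.1.1 = e (some (c, f))) :
    ∃ c' ρ', M.Run c (y₁.1.2 ∘ f) w c' ρ' ∧ c' ∈ M.final := by
  induction h generalizing c f with
  | nil y =>
    rw [h₁, mem_compile_F] at h₂
    obtain ⟨c', hc', f', hf'⟩ := h₂
    cases hf'
    exact ⟨c, _, .nil _ _, hc'⟩
  | cons hs hp ih =>
    cases hs with
    | @std q₁ s₁ q₂ s₂ gas u u' hδ hacc =>
      obtain rfl : q₁ = e (some (c, f)) := h₁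
      obtain ⟨b, y, hE, rfl, rfl⟩ := mem_compile_δ.1 hδ
      cases hE with
      | eps he =>
        cases hacc
        obtain ⟨c', ρ', hr, hc'⟩ := ih h₂ _ _ rfl
        exact ⟨c', ρ', .eps he hr, hc'⟩
      | letter hi hf ht =>
        cases hacc with
        | cons hg hn =>
          cases hn
          obtain ⟨c', ρ', hr, hc'⟩ := ih h₂ _ _ rfl
          rw [elim_write hi hf] at hr
          rw [Guard.sat_ofPattern] at hg
          subst hg
          exact ⟨c', ρ', .letter ht hr, hc'⟩
      | sink =>
        have := path_compile_none hp rfl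
        rw [this, mem_compile_F] at h₂
        simp at h₂
    | skip hn =>
      obtain rfl : _ = e (some (c, f)) := h₁
      exact absurd (stdFrom_compile c f _ _ _) hn

theorem path_of_run_compile [Fintype R] (hp : Fintype.card R + n ≤ p) {c c' : C}
    {ρ ρ' : R → V} {w : List (Fin n → V)} (h : M.Run c ρ w c' ρ') (f : R → Fin p)
    (s : Fin p → V) (hs : s ∘ f = ρ) :
    ∃ f' s', (M.compile e f₀ s₀).Path ((e (some (c, f)), s), w) w
      ((e (some (c', f')), s'), []) := by
  induction h generalizing f s with
  | nil => exact ⟨f, s, .nil _⟩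
  | @eps c ρ w c' c'' ρ'' h he _ ih =>
    subst hs
    obtain ⟨f', s', hpath⟩ := ih (f ∘ h) s rfl
    exact ⟨f', s', .cons (.std (w := [])
      (mem_compile_δ.2 ⟨_, _, .eps he, rfl, rfl⟩) (.nil _)) hpath⟩
  | @letter c ρ ℓ w c' c'' ρ'' h ht _ ih =>
    subst hs
    obtain ⟨d, hd, hf⟩ := exists_fresh hp f
    obtain ⟨f', s', hpath⟩ := ih _ ((Action.write d).run ℓ s) (elim_write hd hf h s ℓ)
    exact ⟨f', s', .cons (.std (w := [ℓ])
      (mem_compile_δ.2 ⟨_, _, .letter (E := fun i j => s i = ℓ j) hd hf ht, rfl, rfl⟩)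
      (.cons ((Guard.sat_ofPattern _ _ _).2 rfl) (.nil _))) hpath⟩

end Compile

/-- Every finite copy automaton is equivalent to some hl-TOPL automaton. -/
theorem exists_hlTOPL [Nonempty V] [Finite C] [Finite R] (M : CopyAutomaton V n C R) :
    ∃ (p k : ℕ) (B : HlTOPL V p n k), B.Lang = M.Lang := by
  have := Fintype.ofFinite R
  let f₀ : R → Fin (Fintype.card R + n) := fun r => Fin.castAdd n (Fintype.equivFin R r)
  have hf₀ : f₀.Injective := (Fin.castAdd_injective _ _).comp (Fintype.equivFin R).injective
  let s₀ := Function.extend f₀ M.store fun _ => Classical.arbitrary V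
  have hs₀ : s₀ ∘ f₀ = M.store := by
    funext r
    simp only [s₀, Function.comp_apply, hf₀.extend_apply]
  refine ⟨_, _, M.compile (Finite.equivFin _) f₀ s₀, Set.ext fun w => ⟨?_, ?_⟩⟩
  · rintro ⟨w₀, q, s, hpath, hq⟩
    have := run_of_path_compile hpath hq M.start f₀ rfl
    rwa [show ((M.compile (Finite.equivFin _) f₀ s₀).s₀) ∘ f₀ = M.store from hs₀] at this
  · rintro ⟨c, ρ, hr, hc⟩
    obtain ⟨f', s', hpath⟩ := path_of_run_compile le_rfl hr f₀ s₀ hs₀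
    exact ⟨w, _, s', hpath, mem_compile_F.2 ⟨c, hc, f', rfl⟩⟩

end CopyAutomaton

/-! ### The Kleene star of a high-level automaton -/

namespace HlTOPL

variable {V : Type} {m n k : ℕ}

/-- The sequence `gas` accepts some prefix of a word from a store. -/
def Matches : (Fin m → V) → List (Guard m n × Action m n) → List (Fin n → V) → Prop
  | _, [], _ => True
  | _, _ :: _, [] => False
  | s, x :: gas, ℓ :: w => Guard.Sat s ℓ x.1 ∧ Matches (x.2.run ℓ s) gas w

theorem matches_iff {s : Fin m → V} {gas : List (Guard m n × Action m n)}
    {w : List (Fin n → V)} :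
    Matches s gas w ↔ ∃ s' u u', w = u ++ u' ∧ SeqAccept s gas u s' := by
  induction gas generalizing s w with
  | nil => exact iff_of_true trivial ⟨s, [], w, rfl, .nil s⟩
  | cons x gas ih =>
    cases w with
    | nil =>
      refine iff_of_false id ?_
      rintro ⟨s', u, u', hu, h⟩
      cases h
      simp at hu
    | cons ℓ w =>
      rw [Matches, ih]
      constructor
      · rintro ⟨hg, s', u, u', rfl, h⟩
        exact ⟨s', ℓ :: u, u', rfl, .cons hg h⟩
      · rintro ⟨s', u, u', hu, h⟩
        cases h with
        | cons hg h =>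
          rw [List.cons_append, List.cons.injEq] at hu
          obtain ⟨rfl, rfl⟩ := hu
          exact ⟨hg, _, _, _, rfl, h⟩

theorem stdFrom_iff {A : HlTOPL V m n k} {q : Fin k} {s : Fin m → V} {w : List (Fin n → V)} :
    A.StdFrom (q, s) w ↔ ∃ gas q', (q, gas, q') ∈ A.δ ∧ Matches s gas w := by
  simp only [matches_iff]
  constructor
  · rintro ⟨q', s', gas, u, u', hw, hδ, h⟩
    exact ⟨gas, q', hδ, s', u, u', hw, h⟩
  · rintro ⟨gas, q', hδ, s', u, u', hw, h⟩
    exact ⟨q', s', gas, u, u', hw, hδ, h⟩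

theorem Path.fst_eq {A : HlTOPL V m n k}
    {y₁ y₂ : (Fin k × (Fin m → V)) × List (Fin n → V)} {w : List (Fin n → V)}
    (h : A.Path y₁ w y₂) : y₁.2 = w ++ y₂.2 := by
  induction h with
  | nil => rfl
  | cons hs _ ih =>
    cases hs with
    | std => simp only at ih ⊢; rw [ih, List.append_assoc]
    | skip => simp only at ih ⊢; rw [ih]; rfl

theorem mem_lang_iff {A : HlTOPL V m n k} {w : List (Fin n → V)} :
    w ∈ A.Lang ↔ ∃ q s, A.Path ((A.q₀, A.s₀), w) w ((q, s), []) ∧ q ∈ A.F := by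
  constructor
  · rintro ⟨w₀, q, s, h, hq⟩
    obtain rfl : w₀ = w := by simpa using h.fst_eq
    exact ⟨q, s, h, hq⟩
  · rintro ⟨q, s, h, hq⟩
    exact ⟨w, q, s, h, hq⟩

/-- The sequences processed by the star automaton: the transition labels, the empty sequence, and
the sequence which reads the letter of a skip transition. -/
def Seqs (A : HlTOPL V m n k) : Set (List (Guard m n × Action m n)) :=
  insert [] (insert [(.tt, .nop)] ((fun t => t.2.1) '' SetLike.coe A.δ))

/-- Partially processed sequences: the pairs already processed, in reverse order, and the
remaining ones. -/
def Item (A : HlTOPL V m n k) : Type :=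
  { i : List (Guard m n × Action m n) × List (Guard m n × Action m n) //
    i.1.reverse ++ i.2 ∈ A.Seqs }

instance (A : HlTOPL V m n k) : Finite A.Item := by
  have hfin : A.Seqs.Finite := ((A.δ.finite_toSet.image _).insert _).insert _
  refine Set.Finite.subset (hfin.biUnion fun l _ =>
    (Set.finite_Iic l.length).image fun j => ((l.take j).reverse, l.drop j)) ?_
  rintro ⟨d, r⟩ h
  exact Set.mem_biUnion h ⟨d.length, by simp, by
    rw [← List.length_reverse (as := d)]; simp⟩

namespace Item

variable {A : HlTOPL V m n k}

/-- The processed part of an item. -/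
def done (i : A.Item) : List (Guard m n × Action m n) := i.1.1

/-- The remaining part of an item. -/
def rem (i : A.Item) : List (Guard m n × Action m n) := i.1.2

/-- The item of a sequence none of which is processed. -/
def fresh {gas : List (Guard m n × Action m n)} (h : gas ∈ A.Seqs) : A.Item := ⟨([], gas), h⟩

/-- The item obtained by processing one more pair. -/
def next : A.Item → A.Item
  | ⟨(d, []), h⟩ => ⟨(d, []), h⟩
  | ⟨(d, x :: r), h⟩ => ⟨(x :: d, r), by simpa using h⟩

theorem rem_next {i : A.Item} {x : Guard m n × Action m n} {r} (h : i.rem = x :: r) :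
    i.next.rem = r := by
  obtain ⟨⟨d, _⟩, _⟩ := i
  obtain rfl : _ = x :: r := h
  rfl

theorem done_next {i : A.Item} {x : Guard m n × Action m n} {r} (h : i.rem = x :: r) :
    i.next.done ≠ [] := by
  obtain ⟨⟨d, _⟩, _⟩ := i
  obtain rfl : _ = x :: r := h
  exact List.cons_ne_nil x d

end Item

theorem nil_mem_seqs (A : HlTOPL V m n k) : [] ∈ A.Seqs := Set.mem_insert _ _

theorem skip_mem_seqs (A : HlTOPL V m n k) : [(.tt, .nop)] ∈ A.Seqs :=
  Set.mem_insert_of_mem _ (Set.mem_insert _ _)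

theorem mem_seqs {A : HlTOPL V m n k} {q q' : Fin k} {gas} (h : (q, gas, q') ∈ A.δ) :
    gas ∈ A.Seqs :=
  Set.mem_insert_of_mem _ (Set.mem_insert_of_mem _ ⟨_, h, rfl⟩)

/-- Registers of the star automaton: the initial store (`none`), the current store
(`some none`), and for each item the store of the corresponding failing attempt. -/
abbrev StarReg (A : HlTOPL V m n k) : Type := Option (Option A.Item) × Fin m

/-- Control states of the star automaton: the boundary between two words (`none`), or a state of
`A` to be reached after the remaining part of an item, with the set of items recording sequences
which must fail to match. -/
abbrev StarCtrl (A : HlTOPL V m n k) : Type := Option ((Fin k × A.Item) × Set A.Item)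

variable {A : HlTOPL V m n k}

/-- Register copying when a new word begins. -/
def resetSrc : A.StarReg → A.StarReg
  | (some none, r) => (none, r)
  | x => x

open Classical in
/-- Register copying when a skip transition is guessed. -/
noncomputable def skipSrc : A.StarReg → A.StarReg
  | (some (some i), r) => if i.done = [] then (some none, r) else (some (some i), r)
  | x => x

/-- Register updates when a letter is read, the current store being transformed by `a`. -/
def letterSrc (a : Action m n) : A.StarReg → A.StarReg ⊕ Fin n
  | (none, r) => .inl (none, r)
  | (some none, r) => Sum.map (Prod.mk (some none)) id (a.src r)
  | (some (some ⟨([], rest), h⟩), r) => .inl (some (some ⟨([], rest), h⟩), r)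
  | (some (some ⟨(x :: d, rest), h⟩), r) =>
    Sum.map (Prod.mk (some (some ⟨(d, x :: rest), by simpa using h⟩))) id (x.2.src r)

/-- The items which survive reading a letter. -/
def advance (E : A.StarReg → Fin n → Prop) (O : Set A.Item) : Set A.Item :=
  { i' | ∃ i ∈ O, ∃ x rest, i.rem = x :: rest ∧
    x.1.Holds (fun r => E (some (some i), r)) ∧ i' = i.next }

/-- The items of the transitions which must fail when a state is skipped. -/
def attempts (A : HlTOPL V m n k) (q : Fin k) : Set A.Item :=
  { i | i.done = [] ∧ ∃ r, (q, i.rem, r) ∈ A.δ }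

/-- Silent moves of the star automaton. -/
inductive StarEps (A : HlTOPL V m n k) :
    A.StarCtrl → A.StarCtrl → (A.StarReg → A.StarReg) → Prop
  | begin : StarEps A none (some ((A.q₀, .fresh A.nil_mem_seqs), ∅)) resetSrc
  | std {q i O gas q'} (h : (q, gas, q') ∈ A.δ) : i.rem = [] →
      StarEps A (some ((q, i), O)) (some ((q', .fresh (mem_seqs h)), O)) id
  | skip {q i O} : i.rem = [] → (∀ j ∈ O, j.done ≠ []) →
      StarEps A (some ((q, i), O)) (some ((q, .fresh A.skip_mem_seqs), O ∪ A.attempts q)) skipSrc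
  | finish {q i O} : i.rem = [] → q ∈ A.F → (∀ j ∈ O, j.rem ≠ []) →
      StarEps A (some ((q, i), O)) none id

/-- Letter moves of the star automaton. -/
inductive StarTr (A : HlTOPL V m n k) :
    A.StarCtrl → (A.StarReg → Fin n → Prop) → A.StarCtrl → (A.StarReg → A.StarReg ⊕ Fin n) → Prop
  | mk {q i O E x rest} : i.rem = x :: rest → x.1.Holds (fun r => E (some none, r)) →
      (∀ j ∈ O, j.rem ≠ []) →
      StarTr A (some ((q, i), O)) E (some ((q, i.next), advance E O)) (letterSrc x.2)

/-- The copy automaton recognizing the Kleene star of the language of `A`. -/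
def star (A : HlTOPL V m n k) : CopyAutomaton V n A.StarCtrl A.StarReg where
  start := none
  store x := A.s₀ x.2
  final := {none}
  eps := A.StarEps
  tr := A.StarTr

/-- The store held in a group of registers. -/
def slot (ρ : A.StarReg → V) (t : Option (Option A.Item)) : Fin m → V := fun r => ρ (t, r)

/-- No tracked item matches a prefix of the word. -/
def Safe (O : Set A.Item) (ρ : A.StarReg → V) (w : List (Fin n → V)) : Prop :=
  ∀ i ∈ O, ¬ Matches (slot ρ (some (some i))) i.rem w

theorem slot_letterSrc_current (ρ : A.StarReg → V) (ℓ : Fin n → V) (a : Action m n) :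
    slot (fun x => Sum.elim ρ ℓ (letterSrc a x)) (some none) = a.run ℓ (slot ρ (some none)) := by
  funext r
  rw [Action.run_apply]
  simp only [slot, letterSrc]
  cases a.src r <;> rfl

theorem slot_letterSrc_next (ρ : A.StarReg → V) (ℓ : Fin n → V) (a : Action m n) {i : A.Item}
    {x : Guard m n × Action m n} {rest} (h : i.rem = x :: rest) :
    slot (fun x => Sum.elim ρ ℓ (letterSrc a x)) (some (some i.next)) =
      x.2.run ℓ (slot ρ (some (some i))) := by
  obtain ⟨⟨d, _⟩, _⟩ := i
  obtain rfl : _ = x :: rest := h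
  funext r
  rw [Action.run_apply]
  simp only [slot, Item.next, letterSrc]
  cases x.2.src r <;> rfl

theorem safe_cons_iff {O : Set A.Item} {ρ : A.StarReg → V} {ℓ : Fin n → V}
    {w : List (Fin n → V)} (a : Action m n) :
    Safe O ρ (ℓ :: w) ↔ (∀ i ∈ O, i.rem ≠ []) ∧
      Safe (advance (fun x j => ρ x = ℓ j) O) (fun x => Sum.elim ρ ℓ (letterSrc a x)) w := by
  constructor
  · refine fun h => ⟨fun i hi hr => h i hi (by rw [hr]; trivial), ?_⟩
    rintro _ ⟨i, hi, x, rest, hr, hx, rfl⟩ hm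
    rw [slot_letterSrc_next ρ ℓ a hr, Item.rem_next hr] at hm
    exact h i hi (by rw [hr]; exact ⟨(Guard.holds_iff_sat _ _ _).1 hx, hm⟩)
  · rintro ⟨hne, h⟩ i hi hm
    obtain ⟨x, rest, hr⟩ := List.exists_cons_of_ne_nil (hne i hi)
    rw [hr] at hm
    refine h i.next ⟨i, hi, x, rest, hr, (Guard.holds_iff_sat _ _ _).2 hm.1, rfl⟩ ?_
    rw [slot_letterSrc_next ρ ℓ a hr, Item.rem_next hr]
    exact hm.2

theorem safe_nil_iff {O : Set A.Item} {ρ : A.StarReg → V} :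
    Safe O ρ [] ↔ ∀ i ∈ O, i.rem ≠ [] := by
  refine forall₂_congr fun i _ => ?_
  cases i.rem <;> simp [Matches]

theorem done_ne_nil_of_mem_advance {E : A.StarReg → Fin n → Prop} {O : Set A.Item} {i : A.Item}
    (h : i ∈ advance E O) : i.done ≠ [] := by
  obtain ⟨j, -, x, rest, hr, -, rfl⟩ := h
  exact Item.done_next hr

theorem safe_skip_iff {O : Set A.Item} {ρ : A.StarReg → V} {q : Fin k}
    {w : List (Fin n → V)} (hO : ∀ i ∈ O, i.done ≠ []) :
    Safe (O ∪ A.attempts q) (ρ ∘ skipSrc) w ↔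
      Safe O ρ w ∧ ¬ A.StdFrom (q, slot ρ (some none)) w := by
  have hold : ∀ i : A.Item, i.done ≠ [] →
      slot (ρ ∘ skipSrc) (some (some i)) = slot ρ (some (some i)) := fun i hi => by
    funext r; simp [slot, skipSrc, hi]
  have hnew : ∀ i : A.Item, i.done = [] →
      slot (ρ ∘ skipSrc) (some (some i)) = slot ρ (some none) := fun i hi => by
    funext r; simp [slot, skipSrc, hi]
  rw [stdFrom_iff]
  constructor
  · refine fun h => ⟨fun i hi => hold i (hO i hi) ▸ h i (.inl hi), ?_⟩
    rintro ⟨gas, q', hδ, hm⟩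
    refine h (.fresh (mem_seqs hδ)) (.inr ⟨rfl, q', hδ⟩) ?_
    rw [hnew _ rfl]
    exact hm
  · rintro ⟨h, hn⟩ i (hi | ⟨hd, q', hδ⟩) hm
    · exact h i hi (hold i (hO i hi) ▸ hm)
    · exact hn ⟨_, q', hδ, hnew i hd ▸ hm⟩

/-- What an accepting run of the star automaton from a given configuration establishes. -/
def Accepts (A : HlTOPL V m n k) (ρ : A.StarReg → V) (w : List (Fin n → V)) : A.StarCtrl → Prop
  | none => w ∈ kstar A.Lang
  | some ((q, i), O) => ∃ u v w' s q' s', w = u ++ v ++ w' ∧ w' ∈ kstar A.Lang ∧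
      SeqAccept (slot ρ (some none)) i.rem u s ∧ A.Path ((q, s), v) v ((q', s'), []) ∧
      q' ∈ A.F ∧ Safe O ρ (u ++ v)

theorem nil_mem_kstar {α : Type} (L : Set (List α)) : [] ∈ kstar L := ⟨[], by simp, rfl⟩

theorem append_mem_kstar {α : Type} {L : Set (List α)} {u w : List α} (hu : u ∈ L)
    (hw : w ∈ kstar L) : u ++ w ∈ kstar L := by
  obtain ⟨ws, hws, rfl⟩ := hw
  exact ⟨u :: ws, List.forall_mem_cons.2 ⟨hu, hws⟩, rfl⟩

theorem accepts_of_run {c c' : A.StarCtrl} {ρ ρ' : A.StarReg → V} {w : List (Fin n → V)}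
    (h : A.star.Run c ρ w c' ρ') (hc' : c' = none) (hρ : slot ρ none = A.s₀) :
    A.Accepts ρ w c := by
  induction h with
  | nil c ρ => subst hc'; exact nil_mem_kstar _
  | eps he _ ih =>
    cases he with
    | begin =>
      obtain ⟨u, v, w', s, q', s', rfl, hw', hacc, hp, hq', -⟩ := ih hc' hρ
      cases hacc
      refine append_mem_kstar (mem_lang_iff.2 ⟨q', s', ?_, hq'⟩) hw'
      rw [← hρ]
      exact hp
    | std hδ hi =>
      obtain ⟨u, v, w', s, q', s', rfl, hw', hacc, hp, hq', hsafe⟩ := ih hc' hρ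
      exact ⟨[], u ++ v, w', _, q', s', rfl, hw', hi ▸ .nil _,
        .cons (.std hδ hacc) hp, hq', hsafe⟩
    | skip hi hO =>
      obtain ⟨u, v, w', s, q', s', rfl, hw', hacc, hp, hq', hsafe⟩ := ih hc' hρ
      rw [safe_skip_iff hO] at hsafe
      cases hacc with
      | cons hg hacc =>
        cases hacc
        exact ⟨[], _ :: v, w', _, q', s', rfl, hw', hi ▸ .nil _,
          .cons (.skip hsafe.2) hp, hq', hsafe.1⟩
    | finish hi hq hO =>
      exact ⟨[], [], _, _, _, _, rfl, ih hc' hρ, by rw [hi]; exact .nil _, .nil _, hq,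
        safe_nil_iff.2 hO⟩
  | letter ht _ ih =>
    cases ht with
    | mk hi hx hO =>
      obtain ⟨u, v, w', s, q', s', rfl, hw', hacc, hp, hq', hsafe⟩ := ih hc' hρ
      rw [slot_letterSrc_current, Item.rem_next hi] at hacc
      exact ⟨_ :: u, v, w', s, q', s', rfl, hw',
        hi ▸ .cons ((Guard.holds_iff_sat _ _ _).1 hx) hacc, hp, hq',
        (safe_cons_iff _).2 ⟨hO, hsafe⟩⟩

theorem run_of_seqAccept {s s' : Fin m → V} {gas : List (Guard m n × Action m n)}
    {u v : List (Fin n → V)} (h : SeqAccept s gas u s') {q : Fin k} {i : A.Item}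
    {O : Set A.Item} {ρ : A.StarReg → V} (hi : i.rem = gas) (hs : slot ρ (some none) = s)
    (hsafe : Safe O ρ (u ++ v)) (hO : gas = [] → ∀ j ∈ O, j.done ≠ []) :
    ∃ i' O' ρ', A.star.Run (some ((q, i), O)) ρ u (some ((q, i'), O')) ρ' ∧ i'.rem = [] ∧
      slot ρ' (some none) = s' ∧ slot ρ' none = slot ρ none ∧ Safe O' ρ' v ∧
      ∀ j ∈ O', j.done ≠ [] := by
  induction h generalizing i O ρ with
  | nil s => exact ⟨i, O, ρ, .nil _ _, hi, hs, rfl, hsafe, hO rfl⟩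
  | @cons s s' g a gas ℓ u hg _ ih =>
    subst hs
    rw [List.cons_append, safe_cons_iff a] at hsafe
    obtain ⟨i', O', ρ', hr, hi', hs', h0, hsafe', hO'⟩ :=
      ih (Item.rem_next hi) (slot_letterSrc_current ρ ℓ a) hsafe.2
        (fun _ _ => done_ne_nil_of_mem_advance)
    exact ⟨i', O', ρ', .letter (.mk hi ((Guard.holds_iff_sat _ _ _).2 hg) hsafe.1) hr,
      hi', hs', h0, hsafe', hO'⟩

theorem run_of_path {y₁ y₂ : (Fin k × (Fin m → V)) × List (Fin n → V)} {w : List (Fin n → V)}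
    (h : A.Path y₁ w y₂) (hy : y₂.2 = []) (hF : y₂.1.1 ∈ A.F) {i : A.Item} {O : Set A.Item}
    {ρ : A.StarReg → V} (hi : i.rem = []) (hs : slot ρ (some none) = y₁.1.2)
    (hsafe : Safe O ρ y₁.2) (hO : ∀ j ∈ O, j.done ≠ []) :
    ∃ ρ', A.star.Run (some ((y₁.1.1, i), O)) ρ w none ρ' ∧ slot ρ' none = slot ρ none := by
  induction h generalizing i O ρ with
  | nil y =>
    rw [hy, safe_nil_iff] at hsafe
    exact ⟨ρ, .eps (.finish hi hF hsafe) (.nil _ _), rfl⟩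
  | cons hstep _ ih =>
    cases hstep with
    | std hδ hacc =>
      obtain ⟨i', O', ρ', hr, hi', hs', h0, hsafe', hO'⟩ :=
        run_of_seqAccept hacc (i := .fresh (mem_seqs hδ)) rfl hs hsafe fun _ => hO
      obtain ⟨ρ'', hr', h0'⟩ := ih hy hF hi' hs' hsafe' hO'
      exact ⟨ρ'', .eps (.std hδ hi) (hr.trans hr'), h0'.trans h0⟩
    | @skip q s ℓ v hn =>
      obtain rfl : _ = s := hs
      obtain ⟨i', O', ρ', hr, hi', hs', h0, hsafe', hO'⟩ :=
        run_of_seqAccept (q := q) (u := [ℓ]) (v := v)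
          (.cons (g := .tt) (a := .nop) trivial (.nil _))
          (i := .fresh A.skip_mem_seqs) (ρ := ρ ∘ skipSrc) rfl rfl
          ((safe_skip_iff hO).2 ⟨hsafe, hn⟩) (by simp)
      obtain ⟨ρ'', hr', h0'⟩ := ih hy hF hi' hs' hsafe' hO'
      exact ⟨ρ'', .eps (.skip hi hO) (hr.trans hr'), h0'.trans h0⟩

theorem run_of_mem_kstar {ws : List (List (Fin n → V))} (hws : ∀ u ∈ ws, u ∈ A.Lang)
    {ρ : A.StarReg → V} (hρ : slot ρ none = A.s₀) :
    ∃ ρ', A.star.Run none ρ ws.flatten none ρ' := by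
  induction ws generalizing ρ with
  | nil => exact ⟨ρ, .nil _ _⟩
  | cons u ws ih =>
    rw [List.forall_mem_cons] at hws
    obtain ⟨q, s, hp, hq⟩ := mem_lang_iff.1 hws.1
    obtain ⟨ρ', hr, h0⟩ := run_of_path hp rfl hq (i := .fresh A.nil_mem_seqs) (O := ∅)
      (ρ := ρ ∘ resetSrc) rfl hρ (fun _ h => h.elim) (fun _ h => h.elim)
    obtain ⟨ρ'', hr'⟩ := ih hws.2 (h0.trans hρ)
    exact ⟨ρ'', .eps .begin (hr.trans hr')⟩

theorem lang_star (A : HlTOPL V m n k) : A.star.Lang = kstar A.Lang := by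
  ext w
  constructor
  · rintro ⟨c, ρ, hr, hc⟩
    exact accepts_of_run hr hc rfl
  · rintro ⟨ws, hws, rfl⟩
    obtain ⟨ρ, hr⟩ := run_of_mem_kstar hws (ρ := A.star.store) rfl
    exact ⟨none, ρ, hr, rfl⟩

end HlTOPL

/-- hl-TOPL-recognizable languages are closed under Kleene star. -/
theorem hlTopl_closed_under_kleeneStar (V : Type) [Infinite V] (n : ℕ)
    (m₁ k₁ : ℕ) (A : HlTOPL V m₁ n k₁) :
    ∃ (m k : ℕ) (B : HlTOPL V m n k), B.Lang = kstar A.Lang := by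
  rw [← A.lang_star]
  exact A.star.exists_hlTOPL

end Topl
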